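/- arXiv:2604.09980 — 6 statements merged into one kernel-verified Lean document; each statement's English description precedes it below -/
import Mathlib

section
/- Let θ ∈ (0, π/2] be a real number. For each integer t ≥ 2, set c_t = (1 − sin(π/(2t)))/(1 + sin(π/(2t))). Then the matrix product E(θ, c_T) · E(θ, c_{T−1}) ⋯ E(θ, c_2) converges to the zero matrix as T → ∞; equivalently, for every vector u₀ ∈ ℝ³ the sequence u_T = E(θ, c_T) ⋯ E(θ, c_2) u₀ converges to 0. (This is the convergence core of the parallel fixed-point quantum search algorithm with the update rule cos φ_t = (1 − sin(π/(2t)))/(1 + sin(π/(2t))).) -/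
open Real Filter

/-- The iteration matrix of the measurement-driven (fixed-point) quantum search
algorithm: `c` plays the role of `cos φ`. -/
noncomputable def E (θ c : ℝ) : Matrix (Fin 3) (Fin 3) ℝ :=
  !![Real.cos (2 * θ) * c, Real.sin (2 * θ) * ((1 + c ^ 2) / 2),
       Real.sin (2 * θ) * ((1 - c ^ 2) / 2);
     -Real.sin (2 * θ) * c, Real.cos (2 * θ) * ((1 + c ^ 2) / 2),
       Real.cos (2 * θ) * ((1 - c ^ 2) / 2);
     0, (1 - c ^ 2) / 2, (1 + c ^ 2) / 2]

/-- The fixed-point update value `c_t = cos φ_t = (1 - sin(π/(2t)))/(1 + sin(π/(2t)))`. -/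
noncomputable def fpc (t : ℕ) : ℝ :=
  (1 - Real.sin (Real.pi / (2 * t))) / (1 + Real.sin (Real.pi / (2 * t)))

/-- The ordered partial product `E(θ, c_T) * E(θ, c_{T-1}) * ⋯ * E(θ, c_2)`
(the empty product for `T < 2`). -/
noncomputable def prodE (θ : ℝ) : ℕ → Matrix (Fin 3) (Fin 3) ℝ
  | 0 => 1
  | t + 1 => (if 2 ≤ t + 1 then E θ (fpc (t + 1)) else 1) * prodE θ t

/-- The squared Euclidean norm of a vector of `ℝ³`. -/
def sqNorm (u : Fin 3 → ℝ) : ℝ := u 0 ^ 2 + u 1 ^ 2 + u 2 ^ 2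

/-- The squared defect of `u` from the line spanned by `(0, 1, 1)`, on which the diagonal
contraction factor of `E θ c` acts trivially. -/
def defect (u : Fin 3 → ℝ) : ℝ := u 0 ^ 2 + (u 1 - u 2) ^ 2

lemma sqNorm_nonneg (u : Fin 3 → ℝ) : 0 ≤ sqNorm u := by
  unfold sqNorm; positivity

lemma defect_nonneg (u : Fin 3 → ℝ) : 0 ≤ defect u := by
  unfold defect; positivity

lemma E_mulVec_zero (θ c : ℝ) (u : Fin 3 → ℝ) :
    (E θ c).mulVec u 0 = cos (2 * θ) * (c * u 0) +
      sin (2 * θ) * ((1 + c ^ 2) / 2 * u 1 + (1 - c ^ 2) / 2 * u 2) := by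
  simp [E, Matrix.mulVec, dotProduct, Fin.sum_univ_three]; ring

lemma E_mulVec_one (θ c : ℝ) (u : Fin 3 → ℝ) :
    (E θ c).mulVec u 1 = -sin (2 * θ) * (c * u 0) +
      cos (2 * θ) * ((1 + c ^ 2) / 2 * u 1 + (1 - c ^ 2) / 2 * u 2) := by
  simp [E, Matrix.mulVec, dotProduct, Fin.sum_univ_three]; ring

lemma E_mulVec_two (θ c : ℝ) (u : Fin 3 → ℝ) :
    (E θ c).mulVec u 2 = (1 - c ^ 2) / 2 * u 1 + (1 + c ^ 2) / 2 * u 2 := by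
  simp [E, Matrix.mulVec, dotProduct, Fin.sum_univ_three]

/-- One step decreases the squared norm by at least a multiple of the defect. -/
lemma sqNorm_E_mulVec_add_le (θ : ℝ) {c : ℝ} (hc0 : 0 ≤ c) (hc1 : c ≤ 1) (u : Fin 3 → ℝ) :
    sqNorm ((E θ c).mulVec u) + (1 - c ^ 2) / 2 * defect u ≤ sqNorm u := by
  have hc2 : c ^ 2 ≤ 1 := pow_le_one₀ hc0 hc1
  have key : sqNorm u - (sqNorm ((E θ c).mulVec u) + (1 - c ^ 2) / 2 * defect u) =
      (1 - c ^ 2) / 2 * u 0 ^ 2 + (1 - c ^ 2) / 2 * c ^ 2 * (u 1 - u 2) ^ 2 := by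
    simp only [sqNorm, defect, E_mulVec_zero, E_mulVec_one, E_mulVec_two]
    linear_combination (-(c * u 0) ^ 2 -
      ((1 + c ^ 2) / 2 * u 1 + (1 - c ^ 2) / 2 * u 2) ^ 2) * sin_sq_add_cos_sq (2 * θ)
  have h : 0 ≤ (1 - c ^ 2) / 2 := by linarith
  have : 0 ≤ (1 - c ^ 2) / 2 * u 0 ^ 2 + (1 - c ^ 2) / 2 * c ^ 2 * (u 1 - u 2) ^ 2 := by positivity
  linarith

lemma sub_sq_le_two_mul (x y : ℝ) : (x - y) ^ 2 ≤ 2 * x ^ 2 + 2 * y ^ 2 := by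
  linarith [sq_nonneg (x + y), add_sq x y, sub_sq x y]

/-- The defects of two consecutive iterates together control the squared norm. -/
lemma sqNorm_le_defect_add_defect (θ : ℝ) {c : ℝ} (hc0 : 0 ≤ c) (hc1 : c ≤ 1) (u : Fin 3 → ℝ) :
    (1 - cos (2 * θ)) * sqNorm u ≤ 13 * (defect u + defect ((E θ c).mulVec u)) := by
  have hc2 : c ^ 2 ≤ 1 := pow_le_one₀ hc0 hc1
  set C := cos (2 * θ)
  set S := sin (2 * θ)
  have hSC : S ^ 2 + C ^ 2 = 1 := sin_sq_add_cos_sq (2 * θ)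
  have hC1 : C ≤ 1 := cos_le_one _
  have hCn : -1 ≤ C := neg_one_le_cos _
  set a := u 0
  set b := u 1 - u 2 with hb
  set z := u 2
  set d := (1 - c ^ 2) / 2 with hd
  have hd0 : 0 ≤ d := by rw [hd]; linarith
  have hd1 : d ≤ 1 / 2 := by rw [hd]; nlinarith [sq_nonneg c]
  set v := (E θ c).mulVec u with hv
  set p := C * (c * a) + S * ((1 - d) * b) with hp
  set q := -S * (c * a) + C * ((1 - d) * b) with hq
  have hx : v 0 = S * z + p := by rw [hv, E_mulVec_zero]; ring
  have hy : v 1 - v 2 = (C - 1) * z + (q - d * b) := by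
    rw [hv, E_mulVec_one, E_mulVec_two]; ring
  have hpq : p ^ 2 + q ^ 2 = (c * a) ^ 2 + ((1 - d) * b) ^ 2 := by
    linear_combination ((c * a) ^ 2 + ((1 - d) * b) ^ 2) * hSC
  have ha : (c * a) ^ 2 ≤ a ^ 2 := by nlinarith [sq_nonneg a]
  have hb1 : ((1 - d) * b) ^ 2 ≤ b ^ 2 := by
    rw [mul_pow]; exact mul_le_of_le_one_left (sq_nonneg b) (by nlinarith)
  have hb2 : (d * b) ^ 2 ≤ 1 / 4 * b ^ 2 := by
    rw [mul_pow]; exact mul_le_mul_of_nonneg_right (by nlinarith) (sq_nonneg b)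
  have hA : p ^ 2 + (q - d * b) ^ 2 ≤ 3 * (a ^ 2 + b ^ 2) := by
    linarith [sub_sq_le_two_mul q (d * b), sq_nonneg p, sq_nonneg a, sq_nonneg b]
  have hz : (2 - 2 * C) * z ^ 2 ≤ 2 * (v 0 ^ 2 + (v 1 - v 2) ^ 2) + 6 * (a ^ 2 + b ^ 2) := by
    have e : (2 - 2 * C) * z ^ 2 = (v 0 - p) ^ 2 + (v 1 - v 2 - (q - d * b)) ^ 2 := by
      rw [hx, hy]; linear_combination (-z ^ 2) * hSC
    linarith [sub_sq_le_two_mul (v 0) p, sub_sq_le_two_mul (v 1 - v 2) (q - d * b)]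
  have hV : sqNorm u ≤ 2 * (a ^ 2 + b ^ 2) + 3 * z ^ 2 := by
    have e : sqNorm u = a ^ 2 + (b + z) ^ 2 + z ^ 2 := by
      simp only [sqNorm, a, b, z]; ring
    rw [e]
    linarith [sq_nonneg (b - z), add_sq b z, sub_sq b z, sq_nonneg a]
  have hQ : 0 ≤ a ^ 2 + b ^ 2 := by positivity
  have hQ' : 0 ≤ v 0 ^ 2 + (v 1 - v 2) ^ 2 := by positivity
  have hm := mul_le_mul_of_nonneg_left hV (sub_nonneg.2 hC1)
  have hm2 : (1 - C) * (a ^ 2 + b ^ 2) ≤ 2 * (a ^ 2 + b ^ 2) :=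
    mul_le_mul_of_nonneg_right (by linarith) hQ
  change _ ≤ 13 * (a ^ 2 + b ^ 2 + (v 0 ^ 2 + (v 1 - v 2) ^ 2))
  linarith

lemma inv_le_sin_pi_div {t : ℕ} (ht : 1 ≤ t) : 1 / (t : ℝ) ≤ sin (π / (2 * t)) := by
  have ht' : (1 : ℝ) ≤ t := by exact_mod_cast ht
  have h := mul_le_sin (x := π / (2 * t)) (by positivity)
    (div_le_div_of_nonneg_left pi_pos.le two_pos (by linarith))
  calc 1 / (t : ℝ) = 2 / π * (π / (2 * t)) := by field_simp
    _ ≤ _ := h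

lemma fpc_nonneg (t : ℕ) (ht : 1 ≤ t) : 0 ≤ fpc t := by
  have h : 0 ≤ sin (π / (2 * t)) := le_trans (by positivity) (inv_le_sin_pi_div ht)
  exact div_nonneg (sub_nonneg.2 (sin_le_one _)) (by linarith)

lemma fpc_le_one (t : ℕ) (ht : 1 ≤ t) : fpc t ≤ 1 := by
  have h : 0 ≤ sin (π / (2 * t)) := le_trans (by positivity) (inv_le_sin_pi_div ht)
  exact div_le_one_of_le₀ (by linarith) (by linarith)

lemma le_one_sub_fpc_sq (t : ℕ) (ht : 1 ≤ t) : 1 / (2 * t : ℝ) ≤ (1 - fpc t ^ 2) / 2 := by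
  have hi := inv_le_sin_pi_div ht
  have h1 := sin_le_one (π / (2 * t))
  have h : 0 ≤ sin (π / (2 * t)) := le_trans (by positivity) hi
  unfold fpc
  set e := sin (π / (2 * t))
  have he : (1 - ((1 - e) / (1 + e)) ^ 2) / 2 = 2 * e / (1 + e) ^ 2 := by
    field_simp; ring
  calc 1 / (2 * t : ℝ) = 1 / (t : ℝ) / 2 := by rw [mul_comm, div_mul_eq_div_div]
    _ ≤ e / 2 := by linarith
    _ ≤ 2 * e / (1 + e) ^ 2 := by
      rw [div_le_div_iff₀ two_pos (by positivity)]
      nlinarith [mul_nonneg h (sub_nonneg.2 (show (1 + e) ^ 2 ≤ 4 by nlinarith))]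
    _ = _ := he.symm

/-- An antitone nonnegative sequence whose two-step decrements dominate a fixed multiple of
`v n / (n + 1)` tends to zero. -/
lemma tendsto_zero_of_two_step_decay {v : ℕ → ℝ} {κ : ℝ} (hκ : 0 < κ) (hv : ∀ n, 0 ≤ v n)
    (hanti : Antitone v) (hdec : ∀ n : ℕ, κ * (1 / ((n : ℝ) + 1)) * v n ≤ v n - v (n + 2)) :
    Tendsto v atTop (nhds 0) := by
  have hbdd : BddBelow (Set.range v) := ⟨0, by rintro _ ⟨n, rfl⟩; exact hv n⟩
  have hlim := tendsto_atTop_ciInf hanti hbdd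
  have hle : ∀ n, (⨅ i, v i) ≤ v n := ciInf_le hbdd
  have h0 : 0 ≤ ⨅ i, v i := le_ciInf hv
  set L := ⨅ i, v i
  rcases h0.eq_or_lt with hL | hL
  · rwa [← hL] at hlim
  exfalso
  have hκL : 0 < κ * L := mul_pos hκ hL
  have hsum (N : ℕ) : ∑ n ∈ Finset.range N, (v n - v (n + 2)) = v 0 + v 1 - v N - v (N + 1) := by
    induction N with
    | zero => simp
    | succ k ih => rw [Finset.sum_range_succ, ih]; ring
  have hs : Summable fun n : ℕ => κ * L * (1 / ((n : ℝ) + 1)) := by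
    refine summable_of_sum_range_le (c := v 0 + v 1) (fun n => by positivity) fun N => ?_
    calc ∑ n ∈ Finset.range N, κ * L * (1 / ((n : ℝ) + 1))
        ≤ ∑ n ∈ Finset.range N, (v n - v (n + 2)) := Finset.sum_le_sum fun n _ => by
          refine le_trans ?_ (hdec n)
          rw [mul_right_comm]
          exact mul_le_mul_of_nonneg_left (hle n) (by positivity)
      _ ≤ v 0 + v 1 := by rw [hsum]; linarith [hv N, hv (N + 1)]
  rw [summable_mul_left_iff hκL.ne'] at hs
  exact not_summable_one_div_natCast <|
    (summable_nat_add_iff (f := fun n : ℕ => 1 / (n : ℝ)) 1).1 (by simpa using hs)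

lemma prodE_succ_mulVec (θ : ℝ) {t : ℕ} (ht : 1 ≤ t) (u : Fin 3 → ℝ) :
    (prodE θ (t + 1)).mulVec u = (E θ (fpc (t + 1))).mulVec ((prodE θ t).mulVec u) := by
  rw [prodE, if_pos (by omega), Matrix.mulVec_mulVec]

lemma tendsto_sqNorm_prodE_mulVec {θ : ℝ} (hθ : cos (2 * θ) < 1) (u : Fin 3 → ℝ) :
    Tendsto (fun T => sqNorm ((prodE θ T).mulVec u)) atTop (nhds 0) := by
  rw [← tendsto_add_atTop_iff_nat 1]
  set w : ℕ → Fin 3 → ℝ := fun n => (prodE θ (n + 1)).mulVec u with hw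
  have hstep (n : ℕ) : w (n + 1) = (E θ (fpc (n + 2))).mulVec (w n) :=
    prodE_succ_mulVec θ (by omega) u
  have hloss (n : ℕ) :
      1 / (2 * ((n : ℝ) + 2)) * defect (w n) ≤ sqNorm (w n) - sqNorm (w (n + 1)) := by
    have h1 := sqNorm_E_mulVec_add_le θ (fpc_nonneg (n + 2) (by omega))
      (fpc_le_one (n + 2) (by omega)) (w n)
    have h2 := le_one_sub_fpc_sq (n + 2) (by omega)
    push_cast at h2
    have h3 := mul_le_mul_of_nonneg_right h2 (defect_nonneg (w n))
    rw [hstep]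
    linarith
  refine tendsto_zero_of_two_step_decay (v := fun n => sqNorm (w n))
    (κ := (1 - cos (2 * θ)) / 78) (by linarith) (fun n => sqNorm_nonneg _)
    (antitone_nat_of_succ_le fun n => ?_) fun n => ?_
  · have : 0 ≤ 1 / (2 * ((n : ℝ) + 2)) * defect (w n) :=
      mul_nonneg (by positivity) (defect_nonneg _)
    linarith [hloss n]
  · have hq := sqNorm_le_defect_add_defect θ (fpc_nonneg (n + 2) (by omega))
      (fpc_le_one (n + 2) (by omega)) (w n)
    rw [← hstep] at hq
    have l0 := hloss n
    have l1 := hloss (n + 1)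
    push_cast at l1
    have i0 : 1 / (6 * ((n : ℝ) + 1)) ≤ 1 / (2 * ((n : ℝ) + 2)) :=
      one_div_le_one_div_of_le (by positivity) (by linarith)
    have i1 : 1 / (6 * ((n : ℝ) + 1)) ≤ 1 / (2 * ((n : ℝ) + 1 + 2)) :=
      one_div_le_one_div_of_le (by positivity) (by linarith)
    have j0 := mul_le_mul_of_nonneg_right i0 (defect_nonneg (w n))
    have j1 := mul_le_mul_of_nonneg_right i1 (defect_nonneg (w (n + 1)))
    calc (1 - cos (2 * θ)) / 78 * (1 / ((n : ℝ) + 1)) * sqNorm (w n)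
        = 1 / (78 * ((n : ℝ) + 1)) * ((1 - cos (2 * θ)) * sqNorm (w n)) := by field_simp
      _ ≤ 1 / (78 * ((n : ℝ) + 1)) * (13 * (defect (w n) + defect (w (n + 1)))) :=
          mul_le_mul_of_nonneg_left hq (by positivity)
      _ = 1 / (6 * ((n : ℝ) + 1)) * defect (w n) + 1 / (6 * ((n : ℝ) + 1)) * defect (w (n + 1)) := by
          field_simp; ring
      _ ≤ sqNorm (w n) - sqNorm (w (n + 2)) := by linarith

lemma sq_le_sqNorm (u : Fin 3 → ℝ) (i : Fin 3) : u i ^ 2 ≤ sqNorm u := by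
  unfold sqNorm
  fin_cases i <;> simp <;> nlinarith [sq_nonneg (u 0), sq_nonneg (u 1), sq_nonneg (u 2)]

lemma tendsto_zero_of_sqNorm {w : ℕ → Fin 3 → ℝ}
    (h : Tendsto (fun n => sqNorm (w n)) atTop (nhds 0)) : Tendsto w atTop (nhds 0) := by
  refine tendsto_pi_nhds.2 fun i => ?_
  have hs : Tendsto (fun n => √(sqNorm (w n))) atTop (nhds 0) := by simpa using h.sqrt
  exact squeeze_zero_norm (fun n => abs_le_sqrt (sq_le_sqNorm (w n) i)) hs

/-- Convergence core of the parallel fixed-point quantum search algorithm with the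
update rule `cos φ_t = (1 - sin(π/(2t)))/(1 + sin(π/(2t)))`: for `θ ∈ (0, π/2]` the
products `E(θ, c_T) ⋯ E(θ, c_2)` converge to the zero matrix as `T → ∞`;
equivalently, `E(θ, c_T) ⋯ E(θ, c_2) u₀ → 0` for every `u₀ ∈ ℝ³`. -/
theorem prodE_tendsto_zero (θ : ℝ) (hθ0 : 0 < θ) (hθ1 : θ ≤ Real.pi / 2) :
    Tendsto (prodE θ) atTop (nhds (0 : Matrix (Fin 3) (Fin 3) ℝ)) ∧
      ∀ u₀ : Fin 3 → ℝ,
        Tendsto (fun T : ℕ => (prodE θ T).mulVec u₀) atTop (nhds (0 : Fin 3 → ℝ)) := by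
  have hcos : cos (2 * θ) < 1 := by
    have := sin_pos_of_pos_of_lt_pi hθ0 (by linarith [pi_pos])
    rw [cos_two_mul']
    nlinarith [sin_sq_add_cos_sq θ]
  have hvec (u : Fin 3 → ℝ) : Tendsto (fun T : ℕ => (prodE θ T).mulVec u) atTop (nhds 0) :=
    tendsto_zero_of_sqNorm (tendsto_sqNorm_prodE_mulVec hcos u)
  refine ⟨tendsto_pi_nhds.2 fun i => tendsto_pi_nhds.2 fun j => ?_, hvec⟩
  simpa using tendsto_pi_nhds.1 (hvec (Pi.single j 1)) i
end

section
/- Let θ ∈ ℝ and set c = (1 − sin θ)/(1 + sin θ), assuming sin θ ≠ −1. Then the characteristic polynomial of the matrix E(θ, c) equals (X − c)³; in particular all three eigenvalues of E(θ, c) are equal to c = (1 − sin θ)/(1 + sin θ). (This is the critical-damping condition of the fixed-point search iteration.) -/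
open Real Polynomial

/-- Critical damping: with `c = (1 - sin θ)/(1 + sin θ)`, the characteristic polynomial
of `E θ c` is `(X - c)³`, so all three eigenvalues equal `c`. -/
theorem charpoly_E_critical (θ : ℝ) (hθ : Real.sin θ ≠ -1)
    (c : ℝ) (hc : c = (1 - Real.sin θ) / (1 + Real.sin θ)) :
    (E θ c).charpoly = (X - C c) ^ 3 := by
  have hs : 1 + Real.sin θ ≠ 0 := fun h => hθ (by linarith)
  have hcos : (1 + Real.cos (2 * θ)) * (1 + c) ^ 2 = 8 * c := by
    rw [Real.cos_two_mul, Real.cos_sq', hc]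
    field_simp
    ring
  refine Polynomial.funext fun x => ?_
  rw [Matrix.eval_charpoly]
  simp only [E, Matrix.det_fin_three, Matrix.sub_apply, Matrix.scalar_apply]
  simp
  linear_combination (x * c - x ^ 2) / 2 * hcos +
    (-c ^ 3 + x * c * (1 + c ^ 2) / 2) * Real.sin_sq_add_cos_sq (2 * θ)
end

section
/- Let θ ∈ ℝ with sin θ ≠ −1 and set c = (1 − sin θ)/(1 + sin θ). Then the matrix N = E(θ, c) − c·I (where I is the 3×3 identity matrix) satisfies N³ = 0; that is, at the critical damping value the iteration matrix differs from c·I by a nilpotent matrix of index at most 3. -/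
open Real

/-- At the critical damping value `c = (1 - sin θ)/(1 + sin θ)`, the iteration matrix
differs from `c • I` by a nilpotent matrix of index at most 3: `(E θ c - c • 1)³ = 0`. -/
theorem nilpotent_E_sub_smul_one (θ : ℝ) (hθ : Real.sin θ ≠ -1)
    (c : ℝ) (hc : c = (1 - Real.sin θ) / (1 + Real.sin θ)) :
    (E θ c - c • (1 : Matrix (Fin 3) (Fin 3) ℝ)) ^ 3 = 0 := by
  have hs : 1 + Real.sin θ ≠ 0 := fun h => hθ (by linarith)
  have hcos : Real.cos (2 * θ) * (1 + c) ^ 2 = 6 * c - 1 - c ^ 2 := by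
    rw [Real.cos_two_mul, Real.cos_sq', hc]
    field_simp
    ring
  have hsq := Real.sin_sq_add_cos_sq (2 * θ)
  unfold E
  generalize Real.cos (2 * θ) = x at *
  generalize Real.sin (2 * θ) = y at *
  clear hc
  ext i j
  fin_cases i <;> fin_cases j <;>
    simp [pow_succ, Matrix.mul_apply, Fin.sum_univ_three] <;> grind
end

section
/- Let θ ∈ ℝ with sin θ ≠ −1, set c = (1 − sin θ)/(1 + sin θ), and let N = E(θ, c) − c·I. Then for every natural number t, the t-th power of the iteration matrix satisfies E(θ, c)^t = c^t·I + (t choose 1)·c^(t−1)·N + (t choose 2)·c^(t−2)·N² (with the convention that binomial coefficients with lower index exceeding t vanish, and interpreting the formula with the terms c^(t−k) absent when k > t). -/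
open Real

/-- The binomial expansion of `(c + N) ^ t` for `N` with vanishing cube. -/
theorem smul_one_add_pow_of_pow_three_eq_zero {R A : Type*} [CommRing R] [Ring A] [Algebra R A]
    (c : R) {N : A} (hN : N ^ 3 = 0) (t : ℕ) :
    (c • (1 : A) + N) ^ t =
      c ^ t • (1 : A) + ((t.choose 1 : R) * c ^ (t - 1)) • N
        + ((t.choose 2 : R) * c ^ (t - 2)) • N ^ 2 := by
  match t with
  | 0 => simp
  | 1 => simp
  | t + 2 =>
    induction t with
    | zero =>
      simp only [zero_add, pow_two, add_mul, mul_add, smul_mul_assoc, mul_smul_comm, one_mul,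
        mul_one]
      norm_num
      module
    | succ t ih =>
      have hN' : N ^ 2 * N = 0 := by rw [← pow_succ, hN]
      have h2 : (t + 3).choose 2 = (t + 2) + (t + 2).choose 2 := by
        rw [Nat.choose_succ_succ', Nat.choose_one_right]
      rw [show t + 1 + 2 = (t + 2) + 1 by ring, pow_succ, ih]
      simp only [Nat.choose_one_right, h2, add_mul, mul_add, smul_mul_assoc, mul_smul_comm,
        one_mul, mul_one, hN', ← pow_two, Nat.add_sub_cancel,
        show t + 2 - 1 = t + 1 by omega, show t + 2 + 1 - 2 = t + 1 by omega]
      push_cast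
      module

/-- At critical damping, `c` is a triple root of the characteristic polynomial of `E θ c`. -/
theorem E_sub_smul_one_pow_three (θ : ℝ) (hθ : Real.sin θ ≠ -1) :
    (E θ ((1 - Real.sin θ) / (1 + Real.sin θ)) -
      ((1 - Real.sin θ) / (1 + Real.sin θ)) • (1 : Matrix (Fin 3) (Fin 3) ℝ)) ^ 3 = 0 := by
  have hs : 1 + Real.sin θ ≠ 0 := fun h => hθ (by linarith)
  have hk := Real.sin_sq_add_cos_sq θ
  unfold E
  rw [Real.sin_two_mul, Real.cos_two_mul']
  generalize Real.sin θ = s at *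
  generalize Real.cos θ = k at *
  ext i j
  fin_cases i <;> fin_cases j <;>
    simp [pow_succ, Matrix.mul_apply, Fin.sum_univ_three] <;>
    field_simp <;> grind

/-- At critical damping `c = (1 - sin θ)/(1 + sin θ)`, with `N = E θ c - c • I`, the
powers of the iteration matrix obey the binomial expansion
`E^t = c^t • I + (t choose 1) c^(t-1) • N + (t choose 2) c^(t-2) • N²`
(the binomial coefficients vanish when the lower index exceeds `t`, and the exponents
use truncated subtraction). -/
theorem pow_E_critical (θ : ℝ) (hθ : Real.sin θ ≠ -1)
    (c : ℝ) (hc : c = (1 - Real.sin θ) / (1 + Real.sin θ))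
    (N : Matrix (Fin 3) (Fin 3) ℝ) (hN : N = E θ c - c • (1 : Matrix (Fin 3) (Fin 3) ℝ))
    (t : ℕ) :
    (E θ c) ^ t =
      c ^ t • (1 : Matrix (Fin 3) (Fin 3) ℝ)
        + ((t.choose 1 : ℝ) * c ^ (t - 1)) • N
        + ((t.choose 2 : ℝ) * c ^ (t - 2)) • N ^ 2 := by
  subst hc hN
  rw [← smul_one_add_pow_of_pow_three_eq_zero _ (E_sub_smul_one_pow_three θ hθ),
    add_sub_cancel]
end

section
/- Let θ ∈ (0, π/2] and set c = (1 − sin θ)/(1 + sin θ), so that 0 ≤ c < 1. Then the powers E(θ, c)^t converge to the zero matrix as t → ∞. (At critical damping, the three quantities Tr(ρ_v A), Tr(ρ_v O), Tr(ρ_v) tracked by the algorithm all diminish as the iterations increase.) -/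
open Real Filter

theorem add_smul_one_pow_of_pow_three_eq_zero {A : Type*} [Ring A] [Algebra ℝ A] {N : A}
    (hN : N ^ 3 = 0) (c : ℝ) (t : ℕ) :
    (N + c • 1) ^ (t + 2) = c ^ (t + 2) • (1 : A) + ((t + 2) * c ^ (t + 1)) • N
      + ((t + 2) * (t + 1) / 2 * c ^ t) • N ^ 2 := by
  have hN' : N ^ 2 * N = 0 := by rw [← pow_succ, hN]
  induction t with
  | zero =>
    simp only [zero_add, pow_two, mul_add, add_mul, smul_mul_assoc, mul_smul_comm, one_mul, mul_one]
    push_cast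
    module
  | succ t ih =>
    rw [pow_succ, show t + 1 + 1 = t + 2 from rfl, ih]
    simp only [mul_add, add_mul, smul_mul_assoc, mul_smul_comm, one_mul, mul_one, hN', ← pow_two]
    push_cast
    module

/-- If `A - c` is nilpotent of order at most three and `|c| < 1`, then `A ^ t` tends to zero. -/
theorem tendsto_pow_zero_of_sub_smul_one_pow_three_eq_zero {A : Type*} [Ring A] [Algebra ℝ A]
    [TopologicalSpace A] [ContinuousAdd A] [ContinuousSMul ℝ A] {a : A} {c : ℝ}
    (hc : |c| < 1) (ha : (a - c • 1) ^ 3 = 0) :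
    Tendsto (fun t : ℕ => a ^ t) atTop (nhds 0) := by
  rw [← tendsto_add_atTop_iff_nat 2]
  have h0 := tendsto_pow_const_mul_const_pow_of_abs_lt_one 0 hc
  have h1 := tendsto_pow_const_mul_const_pow_of_abs_lt_one 1 hc
  have h2 := tendsto_pow_const_mul_const_pow_of_abs_lt_one 2 hc
  have l0 : Tendsto (fun t : ℕ => c ^ (t + 2)) atTop (nhds 0) := by
    convert h0.mul_const (c ^ 2) using 2 <;> ring
  have l1 : Tendsto (fun t : ℕ => ((t : ℝ) + 2) * c ^ (t + 1)) atTop (nhds 0) := by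
    convert (h1.add (h0.const_mul 2)).mul_const c using 2 <;> ring
  have l2 : Tendsto (fun t : ℕ => ((t : ℝ) + 2) * (t + 1) / 2 * c ^ t) atTop (nhds 0) := by
    convert ((h2.add (h1.const_mul 3)).add (h0.const_mul 2)).div_const 2 using 2 <;> ring
  have key := ((l0.smul_const (1 : A)).add (l1.smul_const (a - c • 1))).add
    (l2.smul_const ((a - c • 1) ^ 2))
  simp only [zero_smul, add_zero] at key
  refine key.congr fun t => ?_
  rw [← add_smul_one_pow_of_pow_three_eq_zero ha c t, sub_add_cancel]

/-- At critical damping, `c` is a triple eigenvalue of the iteration matrix. -/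
theorem E_sub_smul_one_pow_three_s4 {θ c : ℝ} (h : c * (1 + Real.sin θ) = 1 - Real.sin θ) :
    (E θ c - c • 1) ^ 3 = 0 := by
  have hs : 1 + Real.sin θ ≠ 0 := by
    intro h0
    rw [h0] at h
    linarith
  obtain rfl : c = (1 - Real.sin θ) / (1 + Real.sin θ) := by field_simp; exact h
  have hk : Real.cos θ ^ 2 = 1 - Real.sin θ ^ 2 := Real.cos_sq' θ
  have h3 : Real.cos θ ^ 3 = Real.cos θ * (1 - Real.sin θ ^ 2) := by rw [← hk]; ring
  simp only [E, Real.sin_two_mul, Real.cos_two_mul']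
  generalize Real.cos θ = k at *
  generalize Real.sin θ = s at *
  rw [hk, pow_succ, pow_two]
  ext i j
  fin_cases i <;> fin_cases j <;>
    simp [Matrix.mul_apply, Fin.sum_univ_three] <;> field_simp <;> ring_nf <;>
    simp only [hk, h3] <;> ring

/-- For `θ ∈ (0, π/2]` and the critical damping value `c = (1 - sin θ)/(1 + sin θ)`
(which satisfies `0 ≤ c < 1`), the powers `E(θ,c)^t` converge to the zero matrix. -/
theorem pow_E_critical_tendsto_zero (θ : ℝ) (hθ0 : 0 < θ) (hθ1 : θ ≤ Real.pi / 2)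
    (c : ℝ) (hc : c = (1 - Real.sin θ) / (1 + Real.sin θ)) :
    (0 ≤ c ∧ c < 1) ∧
      Tendsto (fun t : ℕ => (E θ c) ^ t) atTop (nhds (0 : Matrix (Fin 3) (Fin 3) ℝ)) := by
  have hs : 0 < Real.sin θ := Real.sin_pos_of_pos_of_lt_pi hθ0 (by linarith [Real.pi_pos])
  have hs' : 0 < 1 + Real.sin θ := by linarith
  have hc0 : 0 ≤ c := hc ▸ div_nonneg (by linarith [Real.sin_le_one θ]) hs'.le
  have hc1 : c < 1 := by rw [hc, div_lt_one hs']; linarith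
  refine ⟨⟨hc0, hc1⟩, ?_⟩
  refine tendsto_pow_zero_of_sub_smul_one_pow_three_eq_zero (abs_lt.2 ⟨by linarith, hc1⟩) ?_
  exact E_sub_smul_one_pow_three_s4 (by rw [hc, div_mul_cancel₀ _ hs'.ne'])
end

section
/- For all real numbers θ and c, the determinant of the matrix E(θ, c) equals c³. In particular, writing c = cos φ, the product of the three eigenvalues of the fixed-point search iteration matrix is cos³ φ. -/
open Real

/-- The determinant of the fixed-point search iteration matrix equals `c³`:
the product of its three eigenvalues is `cos³ φ` when `c = cos φ`. -/
theorem det_E (θ c : ℝ) : (E θ c).det = c ^ 3 := by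
  simp only [E, Matrix.det_fin_three, Matrix.of_apply, Matrix.cons_val]
  linear_combination c ^ 3 * Real.sin_sq_add_cos_sq (2 * θ)
end
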